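/- Let X ⊂ ℂ^N be a subset, K ⊂ ℂ^N a compact subset, and Φ : ℂ^N → ℂ^N a Lipschitz map. Suppose C₁, C₂ > 0 are constants such that (1/C₁)·‖x − y‖ ≤ ‖Φ(x) − Φ(y)‖ ≤ C₂·‖x − y‖ for all x, y ∈ X \ K. Suppose (t_j) is a sequence of positive real numbers with t_j → +∞ and L : ℂ^N → ℂ^N is a map such that Φ(t_j·v)/t_j → L(v) as j → ∞, for every v ∈ ℂ^N. Assume moreover that for every v ∈ C_∞(X) there exist ε > 0 and a curve γ : (ε, +∞) → X with γ(t)/t → v as t → +∞. Then (1/C₁)·‖v − w‖ ≤ ‖L(v) − L(w)‖ ≤ C₂·‖v − w‖ for all v, w ∈ C_∞(X). -/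

import Mathlib

/-- The tangent cone at infinity of a subset `A ⊆ ℂ^N`: the set of vectors `v` for which
there are a sequence of points `xᵢ ∈ A` with `‖xᵢ‖ → ∞` and a sequence of positive real
numbers `tᵢ` such that `xᵢ / tᵢ → v`. -/
def tangentConeAtInfinity {N : ℕ} (A : Set (EuclideanSpace ℂ (Fin N))) :
    Set (EuclideanSpace ℂ (Fin N)) :=
  {v | ∃ (x : ℕ → EuclideanSpace ℂ (Fin N)) (t : ℕ → ℝ),
    (∀ i, x i ∈ A) ∧ (∀ i, 0 < t i) ∧
    Filter.Tendsto (fun i => ‖x i‖) Filter.atTop Filter.atTop ∧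
    Filter.Tendsto (fun i => (t i)⁻¹ • x i) Filter.atTop (nhds v)}

open Filter Topology

theorem exists_mem_diff_of_mem_tangentConeAtInfinity {N : ℕ}
    {X K : Set (EuclideanSpace ℂ (Fin N))} (hK : IsCompact K) {v : EuclideanSpace ℂ (Fin N)}
    (hv : v ∈ tangentConeAtInfinity X) : ∃ x, x ∈ X \ K := by
  obtain ⟨x, -, hxX, -, hx, -⟩ := hv
  obtain ⟨R, hR⟩ := hK.isBounded.exists_norm_le
  obtain ⟨i, hi⟩ := (hx.eventually_gt_atTop R).exists
  exact ⟨x i, hxX i, fun h => (hR _ h).not_gt hi⟩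

/-- A vector of the tangent cone at infinity that is the direction of a curve in `X` is the limit
of `xⱼ / tⱼ` for a prescribed sequence `tⱼ → ∞`, with `xⱼ` eventually in `X` and outside a given
compact set. -/
theorem exists_seq_eventually_mem_diff {N : ℕ}
    {X K : Set (EuclideanSpace ℂ (Fin N))} (hK : IsCompact K)
    {t : ℕ → ℝ} (ht : Tendsto t atTop atTop) {v : EuclideanSpace ℂ (Fin N)}
    (hv : v ∈ tangentConeAtInfinity X) {ε : ℝ} {γ : ℝ → EuclideanSpace ℂ (Fin N)}
    (hγX : ∀ s, ε < s → γ s ∈ X) (hγ : Tendsto (fun s => s⁻¹ • γ s) atTop (𝓝 v)) :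
    ∃ x : ℕ → EuclideanSpace ℂ (Fin N),
      (∀ᶠ j in atTop, x j ∈ X \ K) ∧ Tendsto (fun j => (t j)⁻¹ • x j) atTop (𝓝 v) := by
  rcases eq_or_ne v 0 with rfl | hv0
  · -- The given curve may meet the compact set at arbitrarily large times: use a fixed point.
    obtain ⟨x, hx⟩ := exists_mem_diff_of_mem_tangentConeAtInfinity hK hv
    refine ⟨fun _ => x, Eventually.of_forall fun _ => hx, ?_⟩
    simpa using (tendsto_inv_atTop_zero.comp ht).smul_const x
  · have hlim := hγ.comp ht
    refine ⟨fun j => γ (t j), ?_, hlim⟩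
    obtain ⟨R, hR⟩ := hK.isBounded.exists_norm_le
    have hnorm : Tendsto (fun j => t j * ‖(t j)⁻¹ • γ (t j)‖) atTop atTop :=
      ht.atTop_mul_pos (norm_pos_iff.mpr hv0) hlim.norm
    filter_upwards [ht.eventually_gt_atTop ε, ht.eventually_gt_atTop 0,
      hnorm.eventually_gt_atTop R] with j hj hpos hjR
    refine ⟨hγX _ hj, fun h => (hR _ h).not_gt ?_⟩
    rwa [norm_smul, norm_inv, Real.norm_of_nonneg hpos.le, mul_inv_cancel_left₀ hpos.ne'] at hjR

theorem LipschitzWith.tendsto_inv_smul_comp {E F : Type*} [NormedAddCommGroup E] [NormedSpace ℝ E]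
    [NormedAddCommGroup F] [NormedSpace ℝ F] {Φ : E → F} {c : NNReal} (hΦ : LipschitzWith c Φ)
    {t : ℕ → ℝ} (ht : ∀ j, 0 < t j) {v : E} {ℓ : F}
    (hℓ : Tendsto (fun j => (t j)⁻¹ • Φ (t j • v)) atTop (𝓝 ℓ))
    {x : ℕ → E} (hx : Tendsto (fun j => (t j)⁻¹ • x j) atTop (𝓝 v)) :
    Tendsto (fun j => (t j)⁻¹ • Φ (x j)) atTop (𝓝 ℓ) := by
  have hdiff : Tendsto (fun j => (t j)⁻¹ • Φ (x j) - (t j)⁻¹ • Φ (t j • v)) atTop (𝓝 0) := by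
    have hbound : Tendsto (fun j => c * ‖(t j)⁻¹ • x j - v‖) atTop (𝓝 0) := by
      simpa using (tendsto_iff_norm_sub_tendsto_zero.mp hx).const_mul (c : ℝ)
    refine squeeze_zero_norm (fun j => ?_) hbound
    have hscale : (t j)⁻¹ • x j - v = (t j)⁻¹ • (x j - t j • v) := by
      rw [smul_sub, inv_smul_smul₀ (ht j).ne']
    rw [hscale, ← smul_sub, norm_smul, norm_smul, mul_left_comm]
    gcongr
    exact hΦ.norm_sub_le _ _
  simpa using hdiff.add hℓ

/-- If `Φ : ℂ^N → ℂ^N` is Lipschitz and satisfies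
`(1/C₁) ‖x - y‖ ≤ ‖Φ x - Φ y‖ ≤ C₂ ‖x - y‖` on `X \ K` with `K` compact, and `L` is a
limit of the rescalings `v ↦ Φ(tⱼ v)/tⱼ` along a sequence `tⱼ → ∞` of positive reals,
and every `v ∈ C_∞(X)` is reached by a curve `γ` in `X` with `γ(t)/t → v`, then
`(1/C₁) ‖v - w‖ ≤ ‖L v - L w‖ ≤ C₂ ‖v - w‖` for all `v, w ∈ C_∞(X)`. -/
theorem bilip_on_tangentConeAtInfinity {N : ℕ}
    (X K : Set (EuclideanSpace ℂ (Fin N))) (hK : IsCompact K)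
    (Φ : EuclideanSpace ℂ (Fin N) → EuclideanSpace ℂ (Fin N))
    (hΦ : ∃ c : NNReal, LipschitzWith c Φ)
    (C₁ C₂ : ℝ) (hC₁ : 0 < C₁) (hC₂ : 0 < C₂)
    (hbilip : ∀ x ∈ X \ K, ∀ y ∈ X \ K,
      (1 / C₁) * ‖x - y‖ ≤ ‖Φ x - Φ y‖ ∧ ‖Φ x - Φ y‖ ≤ C₂ * ‖x - y‖)
    (t : ℕ → ℝ) (ht : ∀ j, 0 < t j) (htop : Filter.Tendsto t Filter.atTop Filter.atTop)
    (L : EuclideanSpace ℂ (Fin N) → EuclideanSpace ℂ (Fin N))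
    (hL : ∀ v, Filter.Tendsto (fun j => (t j)⁻¹ • Φ (t j • v)) Filter.atTop (nhds (L v)))
    (hcurve : ∀ v ∈ tangentConeAtInfinity X, ∃ ε : ℝ, 0 < ε ∧
      ∃ γ : ℝ → EuclideanSpace ℂ (Fin N), (∀ s, ε < s → γ s ∈ X) ∧
        Filter.Tendsto (fun s => s⁻¹ • γ s) Filter.atTop (nhds v)) :
    ∀ v ∈ tangentConeAtInfinity X, ∀ w ∈ tangentConeAtInfinity X,
      (1 / C₁) * ‖v - w‖ ≤ ‖L v - L w‖ ∧ ‖L v - L w‖ ≤ C₂ * ‖v - w‖ := by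
  obtain ⟨c, hc⟩ := hΦ
  intro v hv w hw
  obtain ⟨ε, -, γ, hγX, hγ⟩ := hcurve v hv
  obtain ⟨δ, -, η, hηX, hη⟩ := hcurve w hw
  obtain ⟨x, hxX, hx⟩ := exists_seq_eventually_mem_diff hK htop hv hγX hγ
  obtain ⟨y, hyX, hy⟩ := exists_seq_eventually_mem_diff hK htop hw hηX hη
  have hdom := (hx.sub hy).norm
  have himg := ((hc.tendsto_inv_smul_comp ht (hL v) hx).sub
    (hc.tendsto_inv_smul_comp ht (hL w) hy)).norm
  constructor
  · refine le_of_tendsto_of_tendsto (hdom.const_mul _) himg ?_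
    filter_upwards [hxX, hyX] with j hxj hyj
    rw [← smul_sub, ← smul_sub, norm_smul, norm_smul, mul_left_comm]
    gcongr
    exact (hbilip _ hxj _ hyj).1
  · refine le_of_tendsto_of_tendsto himg (hdom.const_mul _) ?_
    filter_upwards [hxX, hyX] with j hxj hyj
    rw [← smul_sub, ← smul_sub, norm_smul, norm_smul, mul_left_comm]
    gcongr
    exact (hbilip _ hxj _ hyj).2
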